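/- Fix b > 0 and λ ∈ ℝ. There exist constants C > 0 and β_c ∈ (0,1] such that sup_{β ∈ (0,β_c)} ∫_ℝ (β^{−1}·V'(βη))² dν_{β,b,λ}(η) ≤ C; that is, the second moment of ξ = β^{−1}V'(βη) under the Gibbs measure is bounded uniformly over small β. -/

import Mathlib

open MeasureTheory

/-- The unnormalized Gibbs density `exp(-b V_β(η) + λ η)` with `V_β(η) = β⁻² V(βη)`. -/
noncomputable def gibbsDensity (V : ℝ → ℝ) (β b lam : ℝ) (η : ℝ) : ℝ :=
  Real.exp (-b * (V (β * η) / β ^ 2) + lam * η)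

/-- The partition function `Z_{β,b,λ}`. -/
noncomputable def partitionZ (V : ℝ → ℝ) (β b lam : ℝ) : ℝ :=
  ∫ η : ℝ, gibbsDensity V β b lam η

/-- The Gibbs probability measure `ν_{β,b,λ}`. -/
noncomputable def gibbsMeasure (V : ℝ → ℝ) (β b lam : ℝ) : Measure ℝ :=
  (volume : Measure ℝ).withDensity
    (fun η => ENNReal.ofReal (gibbsDensity V β b lam η / partitionZ V β b lam))

/-- A function vanishing at `0` whose derivative is bounded by `C` on `[-|x|, |x|]` is bounded
by `C * |x|` at `x`. -/
lemma abs_le_mul_abs_of_abs_deriv_le {f : ℝ → ℝ} (hf : Differentiable ℝ f) (h0 : f 0 = 0)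
    {C x : ℝ} (h : ∀ y, |y| ≤ |x| → |deriv f y| ≤ C) : |f x| ≤ C * |x| := by
  have := (convex_closedBall (0 : ℝ) |x|).norm_image_sub_le_of_norm_deriv_le (f := f) (C := C)
    (x := 0) (y := x) (fun y _ => hf y)
    (fun y hy => by simpa using h y (by simpa using hy)) (by simp) (by simp)
  simpa [h0] using this

/-- A differentiable convex function lies above its tangent lines. -/
lemma ConvexOn.add_deriv_mul_sub_le {f : ℝ → ℝ} (hc : ConvexOn ℝ Set.univ f)
    (hf : Differentiable ℝ f) (a x : ℝ) : f a + deriv f a * (x - a) ≤ f x := by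
  rcases lt_trichotomy a x with h | h | h
  · have := hc.deriv_le_slope (Set.mem_univ a) (Set.mem_univ x) h (hf a)
    rw [slope_def_field, le_div_iff₀ (by linarith)] at this
    linarith
  · simp [h]
  · have := hc.slope_le_deriv (Set.mem_univ x) (Set.mem_univ a) h (hf a)
    rw [slope_def_field, div_le_iff₀ (by linarith)] at this
    linarith

lemma integrable_exp_neg_abs : Integrable (fun x : ℝ => Real.exp (-|x|)) := by
  rw [← integrableOn_univ, ← Set.Iic_union_Ioi (a := (0 : ℝ)), integrableOn_union]
  constructor
  · refine (integrableOn_exp_Iic 0).congr_fun (fun x hx => ?_) measurableSet_Iic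
    simp [abs_of_nonpos (Set.mem_Iic.1 hx)]
  · refine (integrableOn_exp_neg_Ioi 0).congr_fun (fun x hx => ?_) measurableSet_Ioi
    simp [abs_of_pos (Set.mem_Ioi.1 hx)]

/-- A convex non-negative `V` with `V'(y) ~ y` near `0` has, for small `β`, a rescaled potential
growing at least linearly with slope `K`. -/
lemma mul_abs_sub_le_rescaled {V : ℝ → ℝ} (hc : ConvexOn ℝ Set.univ V)
    (hd : Differentiable ℝ V) (hnonneg : ∀ x, 0 ≤ V x) {δ : ℝ}
    (hδ : ∀ y, |y| < δ → |deriv V y - y| ≤ |y| / 2) {K β : ℝ} (hK : 0 < K) (hβ : 0 < β)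
    (hβK : β * (2 * K) < δ) (η : ℝ) : K * |η| - 2 * K ^ 2 ≤ V (β * η) / β ^ 2 := by
  rw [le_div_iff₀ (by positivity)]
  have hp : 0 < β * (2 * K) := by positivity
  rcases le_or_gt |η| (2 * K) with h | h
  · have h1 : K * |η| - 2 * K ^ 2 ≤ 0 := by nlinarith
    exact (mul_nonpos_of_nonpos_of_nonneg h1 (by positivity)).trans (hnonneg _)
  rcases le_or_gt 0 η with h0 | h0
  · rw [abs_of_nonneg h0] at h ⊢
    have h1 := hδ (β * (2 * K)) (by rwa [abs_of_pos hp])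
    rw [abs_of_pos hp] at h1
    have h2 := (abs_le.1 h1).1
    have h3 := hc.add_deriv_mul_sub_le hd (β * (2 * K)) (β * η)
    have h4 : 0 ≤ β * η - β * (2 * K) := by nlinarith
    have h5 := mul_le_mul_of_nonneg_right
      (show β * K ≤ deriv V (β * (2 * K)) by linarith) h4
    have h6 := hnonneg (β * (2 * K))
    nlinarith
  · rw [abs_of_neg h0] at h ⊢
    have h1 := hδ (-(β * (2 * K))) (by rwa [abs_neg, abs_of_pos hp])
    rw [abs_neg, abs_of_pos hp] at h1
    have h2 := (abs_le.1 h1).2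
    have h3 := hc.add_deriv_mul_sub_le hd (-(β * (2 * K))) (β * η)
    have h4 : 0 ≤ -(β * η) - β * (2 * K) := by nlinarith
    have h5 := mul_le_mul_of_nonneg_right
      (show β * K ≤ -deriv V (-(β * (2 * K))) by linarith) h4
    have h6 := hnonneg (-(β * (2 * K)))
    nlinarith

/-- A lower bound on the integral of a non-negative function by its infimum on `[0, 1]`. -/
lemma le_integral_of_le_on_Icc {g : ℝ → ℝ} (hg : Integrable g) (h0 : ∀ x, 0 ≤ g x) {c : ℝ}
    (h : ∀ x ∈ Set.Icc (0 : ℝ) 1, c ≤ g x) : c ≤ ∫ x, g x := by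
  have h1 := setIntegral_ge_of_const_le_real (μ := volume) measurableSet_Icc (by simp) h
    hg.integrableOn
  have h2 := setIntegral_le_integral (s := Set.Icc (0 : ℝ) 1) hg (Filter.Eventually.of_forall h0)
  simpa using h1.trans h2

/-- If `F * g` is dominated by `A * h` with `h` integrable, then the average of `F` against the
density `g` is controlled by any positive lower bound `c` on the normalization `Z`. -/
lemma lintegral_withDensity_div_le {F g h : ℝ → ℝ} (hF : Measurable F) (hg : Measurable g)
    (hh : Integrable h) (hh0 : ∀ x, 0 ≤ h x) (hg0 : ∀ x, 0 ≤ g x) (hF0 : ∀ x, 0 ≤ F x)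
    {A c Z : ℝ} (hA : 0 ≤ A) (hc : 0 < c) (hcZ : c ≤ Z) (hb : ∀ x, g x * F x ≤ A * h x) :
    ∫⁻ x, ENNReal.ofReal (F x) ∂((volume : Measure ℝ).withDensity
      (fun x => ENNReal.ofReal (g x / Z))) ≤ ENNReal.ofReal (A / c * ∫ x, h x) := by
  have hZ : 0 < Z := hc.trans_le hcZ
  rw [lintegral_withDensity_eq_lintegral_mul _ (hg.div_const Z).ennreal_ofReal
    hF.ennreal_ofReal, ← integral_const_mul,
    ofReal_integral_eq_lintegral_ofReal (hh.const_mul _)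
      (Filter.Eventually.of_forall fun x => mul_nonneg (by positivity) (hh0 x))]
  refine lintegral_mono fun x => ?_
  rw [Pi.mul_apply, ← ENNReal.ofReal_mul (div_nonneg (hg0 x) hZ.le)]
  refine ENNReal.ofReal_le_ofReal ?_
  calc g x / Z * F x = g x * F x / Z := by ring
    _ ≤ g x * F x / c := by
      have := mul_nonneg (hg0 x) (hF0 x)
      gcongr
    _ ≤ A * h x / c := div_le_div_of_nonneg_right (hb x) hc.le
    _ = A / c * h x := by ring

/-- Fix `b > 0` and `λ ∈ ℝ`. Under Assumption 2.1 on `V`, there exist `C > 0` and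
`β_c ∈ (0,1]` such that `∫ (β⁻¹ V'(βη))² dν_{β,b,λ}(η) ≤ C` for all `β ∈ (0, β_c)`:
the second moment of `ξ = β⁻¹ V'(βη)` is bounded uniformly over small `β`. -/
theorem second_moment_xi_uniform_bound
    (V : ℝ → ℝ) (γV M : ℝ) (hγV : 0 < γV) (hM : 0 < M)
    (hsmooth : ContDiff ℝ (⊤ : ℕ∞) V) (hconv : ConvexOn ℝ Set.univ V)
    (hnonneg : ∀ x : ℝ, 0 ≤ V x) (hV0 : V 0 = 0) (hV'0 : deriv V 0 = 0)
    (hV''0 : iteratedDeriv 2 V 0 = 1)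
    (hgrowth : ∀ k : ℕ, k ≤ 5 → ∀ x : ℝ, |iteratedDeriv k V x| ≤ M * Real.exp (γV * |x|))
    (b lam : ℝ) (hb : 0 < b) :
    ∃ C > (0 : ℝ), ∃ βc ∈ Set.Ioc (0 : ℝ) 1, ∀ β ∈ Set.Ioo (0 : ℝ) βc,
      Integrable (gibbsDensity V β b lam) ∧
      (∫⁻ η : ℝ, ENNReal.ofReal ((deriv V (β * η) / β) ^ 2) ∂(gibbsMeasure V β b lam))
        ≤ ENNReal.ofReal C := by
  have hd : Differentiable ℝ V := hsmooth.differentiable (by simp)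
  have hcd : ContDiff ℝ 1 (deriv V) := by
    have h2 : ContDiff ℝ (1 + 1) V := hsmooth.of_le (by
      rw [one_add_one_eq_two]
      exact WithTop.coe_le_coe.2 (le_top : (2 : ℕ∞) ≤ ⊤))
    exact (contDiff_succ_iff_deriv.1 h2).2.2
  have hd' : Differentiable ℝ (deriv V) := hcd.differentiable (by simp)
  have hiter : iteratedDeriv 2 V = deriv (deriv V) := by
    rw [iteratedDeriv_succ, iteratedDeriv_one]
  rw [hiter] at hV''0
  have hVd : ∀ R x : ℝ, |x| ≤ R → |deriv V x| ≤ M * Real.exp (γV * R) * |x| := by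
    intro R x hx
    refine abs_le_mul_abs_of_abs_deriv_le hd' hV'0 fun y hy => ?_
    have := hgrowth 2 (by norm_num) y
    rw [hiter] at this
    refine this.trans ?_
    gcongr
    exact hy.trans hx
  have hVq : ∀ x : ℝ, |x| ≤ 1 → V x ≤ M * Real.exp γV * |x| ^ 2 := by
    intro x hx
    have : |V x| ≤ M * Real.exp γV * |x| * |x| := by
      refine abs_le_mul_abs_of_abs_deriv_le hd hV0 fun y hy => ?_
      have := hVd 1 y (hy.trans hx)
      rw [mul_one] at this
      refine this.trans ?_
      gcongr
    calc V x ≤ |V x| := le_abs_self _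
      _ ≤ _ := this
      _ = _ := by ring
  obtain ⟨δ, hδ0, hδ⟩ : ∃ δ > 0, ∀ y, |y| < δ → |deriv V y - y| ≤ |y| / 2 := by
    have h1 := (hd' 0).hasDerivAt.isLittleO
    have h2 := h1.def (c := 1 / 2) (by norm_num)
    obtain ⟨δ, h0, h3⟩ := Metric.eventually_nhds_iff.1 h2
    refine ⟨δ, h0, fun y hy => ?_⟩
    have := h3 (y := y) (by simpa using hy)
    simp only [hV'0, hV''0, sub_zero, smul_eq_mul, mul_one, Real.norm_eq_abs] at this
    linarith
  set K : ℝ := (|lam| + 2 * γV + 2) / b with hKdef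
  have hK : 0 < K := by positivity
  have hbK : b * K = |lam| + 2 * γV + 2 := by rw [hKdef]; field_simp
  have hI : 0 ≤ ∫ x : ℝ, Real.exp (-|x|) := integral_nonneg fun x => (Real.exp_pos _).le
  set c : ℝ := Real.exp (-(b * (M * Real.exp γV)) - |lam|)
  have hc : 0 < c := Real.exp_pos _
  set E : ℝ := Real.exp (2 * b * K ^ 2)
  have hE : 0 < E := Real.exp_pos _
  refine ⟨2 * M ^ 2 * E / c * (∫ x : ℝ, Real.exp (-|x|)) + 1, by positivity,
    min 1 (δ / (2 * K)), ⟨lt_min one_pos (by positivity), min_le_left _ _⟩, ?_⟩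
  rintro β ⟨hβ, hβc⟩
  have hβ1 : β < 1 := hβc.trans_le (min_le_left _ _)
  have hβK : β * (2 * K) < δ :=
    (lt_div_iff₀ (by positivity)).1 (hβc.trans_le (min_le_right _ _))
  have hcont : Continuous (gibbsDensity V β b lam) := by
    have := hd.continuous
    unfold gibbsDensity
    fun_prop
  have hg0 : ∀ η, 0 ≤ gibbsDensity V β b lam η := fun η => (Real.exp_pos _).le
  have hlam : ∀ η, |lam * η| ≤ |lam| * |η| := fun η => (abs_mul _ _).le
  have hdens : ∀ η, gibbsDensity V β b lam η ≤ E * Real.exp (-((2 * γV + 2) * |η|)) := by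
    intro η
    rw [gibbsDensity, ← Real.exp_add]
    refine Real.exp_le_exp.2 ?_
    have h1 := mul_le_mul_of_nonneg_left
      (mul_abs_sub_le_rescaled hconv hd hnonneg hδ hK hβ hβK η) hb.le
    have h2 : b * (K * |η| - 2 * K ^ 2)
        = (|lam| + 2 * γV + 2) * |η| - 2 * b * K ^ 2 := by rw [← hbK]; ring
    have h3 := (le_abs_self _).trans (hlam η)
    linarith
  have hint : Integrable (gibbsDensity V β b lam) := by
    refine (integrable_exp_neg_abs.const_mul E).mono' hcont.aestronglyMeasurable
      (Filter.Eventually.of_forall fun η => ?_)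
    rw [Real.norm_eq_abs, abs_of_nonneg (hg0 η)]
    refine (hdens η).trans ?_
    gcongr
    nlinarith [abs_nonneg η]
  refine ⟨hint, ?_⟩
  have hZ : c ≤ partitionZ V β b lam := by
    refine le_integral_of_le_on_Icc hint hg0 fun η hη => Real.exp_le_exp.2 ?_
    have habs : |η| ≤ 1 := abs_le.2 ⟨by linarith [hη.1], hη.2⟩
    have h1 : V (β * η) / β ^ 2 ≤ M * Real.exp γV := by
      rw [div_le_iff₀ (by positivity)]
      have h2 : |β * η| ≤ β := by
        rw [abs_mul, abs_of_pos hβ]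
        exact mul_le_of_le_one_right hβ.le habs
      refine (hVq _ (h2.trans hβ1.le)).trans ?_
      gcongr
    have h3 := mul_le_mul_of_nonneg_left h1 hb.le
    have h4 := (abs_le.1 ((hlam η).trans
      (mul_le_of_le_one_right (abs_nonneg lam) habs))).1
    linarith
  have hxi : ∀ η, (deriv V (β * η) / β) ^ 2
      ≤ 2 * M ^ 2 * Real.exp ((2 * γV + 1) * |η|) := by
    intro η
    have h1 : |deriv V (β * η) / β| ≤ M * Real.exp (γV * |η|) * |η| := by
      rw [abs_div, abs_of_pos hβ, div_le_iff₀ hβ]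
      have h2 : |β * η| = β * |η| := by rw [abs_mul, abs_of_pos hβ]
      have h3 := hVd |η| (β * η) (by
        rw [h2]; exact mul_le_of_le_one_left (abs_nonneg η) hβ1.le)
      rw [h2] at h3
      linarith
    have h4 : |η| ^ 2 ≤ 2 * Real.exp |η| := by
      have := Real.quadratic_le_exp_of_nonneg (abs_nonneg η)
      linarith [abs_nonneg η]
    calc (deriv V (β * η) / β) ^ 2 = |deriv V (β * η) / β| ^ 2 := (sq_abs _).symm
      _ ≤ (M * Real.exp (γV * |η|) * |η|) ^ 2 := by gcongr
      _ = M ^ 2 * Real.exp (γV * |η|) ^ 2 * |η| ^ 2 := by ring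
      _ ≤ M ^ 2 * Real.exp (γV * |η|) ^ 2 * (2 * Real.exp |η|) := by gcongr
      _ = 2 * M ^ 2 * (Real.exp (γV * |η|) * Real.exp (γV * |η|) * Real.exp |η|) := by ring
      _ = 2 * M ^ 2 * Real.exp ((2 * γV + 1) * |η|) := by
        rw [← Real.exp_add, ← Real.exp_add]
        ring_nf
  have hmeas : Continuous fun η => (deriv V (β * η) / β) ^ 2 := by
    have := hd'.continuous
    fun_prop
  refine (lintegral_withDensity_div_le hmeas.measurable hcont.measurable integrable_exp_neg_abs
    (fun x => (Real.exp_pos _).le) hg0 (fun x => sq_nonneg _) (A := 2 * M ^ 2 * E)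
    (by positivity) hc hZ fun η => ?_).trans (ENNReal.ofReal_le_ofReal (by linarith))
  calc gibbsDensity V β b lam η * (deriv V (β * η) / β) ^ 2
      ≤ E * Real.exp (-((2 * γV + 2) * |η|))
        * (2 * M ^ 2 * Real.exp ((2 * γV + 1) * |η|)) :=
        mul_le_mul (hdens η) (hxi η) (sq_nonneg _) (by positivity)
    _ = 2 * M ^ 2 * E
        * (Real.exp (-((2 * γV + 2) * |η|)) * Real.exp ((2 * γV + 1) * |η|)) := by ring
    _ = 2 * M ^ 2 * E * Real.exp (-|η|) := by
      rw [← Real.exp_add]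
      ring_nf
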